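/- Suppose e = b·γ with b ∈ (0, 1). Let b ∈ ℝⁿ be any vector, let x* = H_γ⁻¹Aᵀb, and define iterates x⁽⁰⁾ = 0 and x⁽ᵗ⁺¹⁾ = x⁽ᵗ⁾ − Ĥ⁻¹·((AᵀA + γI_d)x⁽ᵗ⁾ − Aᵀb), where Ĥ = BᵀB + (δ+γ)·I_d. Then for every t ≥ 0, ‖x⁽ᵗ⁾ − x*‖₂ ≤ (b/(2−b))ᵗ · ‖x*‖₂. -/

import Mathlib

open Matrix

/-- Euclidean (ℓ²) norm on `ℝ^d`. -/
noncomputable def eNorm {d : ℕ} (x : Fin d → ℝ) : ℝ :=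
  ‖(WithLp.equiv 2 (Fin d → ℝ)).symm x‖

theorem eNorm_nonneg {d : ℕ} (x : Fin d → ℝ) : 0 ≤ eNorm x := norm_nonneg _

theorem eNorm_sq {d : ℕ} (x : Fin d → ℝ) : eNorm x ^ 2 = x ⬝ᵥ x := by
  rw [eNorm, EuclideanSpace.norm_sq_eq]
  simp [dotProduct, ← pow_two]

theorem eNorm_neg {d : ℕ} (x : Fin d → ℝ) : eNorm (-x) = eNorm x := by
  rw [← sq_eq_sq₀ (eNorm_nonneg _) (eNorm_nonneg _), eNorm_sq, eNorm_sq, neg_dotProduct_neg]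

/-- The bilinear form of a matrix with `0 ⪯ E ⪯ c • 1` is bounded by `c`. -/
theorem dotProduct_mulVec_le_of_posSemidef {d : ℕ} {E : Matrix (Fin d) (Fin d) ℝ} {c : ℝ}
    (hE : E.PosSemidef) (hcE : (c • (1 : Matrix (Fin d) (Fin d) ℝ) - E).PosSemidef)
    (hc : 0 ≤ c) (v u : Fin d → ℝ) : v ⬝ᵥ (E *ᵥ u) ≤ c * (eNorm v * eNorm u) := by
  have hv := eNorm_nonneg v
  have hu := eNorm_nonneg u
  have hv2 := eNorm_sq v
  have hu2 := eNorm_sq u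
  generalize eNorm v = β at *
  generalize eNorm u = α at *
  rcases hv.eq_or_lt with rfl | hv
  · have : v = 0 := dotProduct_self_eq_zero.mp (by linarith)
    simp [this]
  rcases hu.eq_or_lt with rfl | hu
  · have : u = 0 := dotProduct_self_eq_zero.mp (by linarith)
    simp [this]
  have hsymm : u ⬝ᵥ (E *ᵥ v) = v ⬝ᵥ (E *ᵥ u) := by
    have hT : Eᵀ = E := by simpa using hE.isHermitian.eq
    rw [dotProduct_mulVec, ← mulVec_transpose, hT, dotProduct_comm]
  have hplus := hcE.dotProduct_mulVec_nonneg (α • v + β • u)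
  have hminus := hE.dotProduct_mulVec_nonneg (α • v - β • u)
  have hcs : 0 ≤ (α • v - β • u) ⬝ᵥ (α • v - β • u) := by
    rw [← eNorm_sq]
    positivity
  simp only [star_trivial, sub_mulVec, smul_mulVec, one_mulVec, mulVec_add, mulVec_sub,
    mulVec_smul, dotProduct_add, dotProduct_sub, add_dotProduct, sub_dotProduct,
    dotProduct_smul, smul_dotProduct, smul_eq_mul, hsymm, ← hv2, ← hu2,
    dotProduct_comm u v] at hplus hminus hcs
  have hαβ : 0 < α * β := mul_pos hu hv
  refine le_of_mul_le_mul_left ?_ hαβ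
  nlinarith [mul_nonneg hc hcs]

theorem eNorm_le_of_mulVec_eq {d : ℕ} {K E : Matrix (Fin d) (Fin d) ℝ} {γ c : ℝ}
    (hγ : 0 < γ) (hc : 0 ≤ c)
    (hK : (K - γ • (1 : Matrix (Fin d) (Fin d) ℝ)).PosSemidef)
    (hE : E.PosSemidef) (hcE : (c • (1 : Matrix (Fin d) (Fin d) ℝ) - E).PosSemidef)
    {w u : Fin d → ℝ} (h : K *ᵥ w = E *ᵥ u) : eNorm w ≤ c / γ * eNorm u := by
  have hlower := hK.dotProduct_mulVec_nonneg w
  have hupper := dotProduct_mulVec_le_of_posSemidef hE hcE hc w u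
  simp only [star_trivial, sub_mulVec, smul_mulVec, one_mulVec, dotProduct_sub,
    dotProduct_smul, smul_eq_mul, h, ← eNorm_sq] at hlower
  rcases (eNorm_nonneg w).eq_or_lt with hw | hw
  · rw [← hw]
    exact mul_nonneg (div_nonneg hc hγ.le) (eNorm_nonneg u)
  · rw [div_mul_eq_mul_div, le_div_iff₀ hγ]
    refine le_of_mul_le_mul_left ?_ hw
    linarith

/-- A regularized Gram matrix is positive definite. -/
theorem posDef_transpose_mul_self_add_smul_one {n d : ℕ} (A : Matrix (Fin n) (Fin d) ℝ)
    {γ : ℝ} (hγ : 0 < γ) : (Aᵀ * A + γ • (1 : Matrix (Fin d) (Fin d) ℝ)).PosDef := by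
  have hA : (Aᵀ * A).PosSemidef := by simpa using posSemidef_conjTranspose_mul_self A
  exact Matrix.PosDef.posSemidef_add hA (Matrix.PosDef.one.smul hγ)

/-- Convergence of iterative Robust Frequent Directions ridge
regression: if `e = b·γ` with `b ∈ (0,1)`, `x⁽⁰⁾ = 0` and
`x⁽ᵗ⁺¹⁾ = x⁽ᵗ⁾ − Ĥ⁻¹((AᵀA + γI)x⁽ᵗ⁾ − Aᵀy)` with `Ĥ = BᵀB + (δ+γ)I`, then
`‖x⁽ᵗ⁾ − x*‖ ≤ (b/(2−b))ᵗ‖x*‖` where `x* = H_γ⁻¹Aᵀy`. -/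
theorem rfd_iterative_convergence
    {n m d : ℕ} (A : Matrix (Fin n) (Fin d) ℝ) (B : Matrix (Fin m) (Fin d) ℝ)
    (γ e δ b : ℝ) (hγ : 0 < γ) (hδ : 0 ≤ δ) (hb : b ∈ Set.Ioo (0 : ℝ) 1) (he : e = b * γ)
    (hRFD₁ : ((Bᵀ * B + δ • (1 : Matrix (Fin d) (Fin d) ℝ)) -
        (Aᵀ * A - (e / 2) • (1 : Matrix (Fin d) (Fin d) ℝ))).PosSemidef)
    (hRFD₂ : (Aᵀ * A - (Bᵀ * B + δ • (1 : Matrix (Fin d) (Fin d) ℝ))).PosSemidef)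
    (y : Fin n → ℝ) (x : ℕ → Fin d → ℝ)
    (hx0 : x 0 = 0)
    (hxstep : ∀ t, x (t + 1) = x t -
        (Bᵀ * B + (δ + γ) • (1 : Matrix (Fin d) (Fin d) ℝ))⁻¹ *ᵥ
          ((Aᵀ * A + γ • (1 : Matrix (Fin d) (Fin d) ℝ)) *ᵥ x t - Aᵀ *ᵥ y)) :
    ∀ t : ℕ,
      eNorm (x t - (Aᵀ * A + γ • (1 : Matrix (Fin d) (Fin d) ℝ))⁻¹ *ᵥ (Aᵀ *ᵥ y))
        ≤ (b / (2 - b)) ^ t *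
            eNorm ((Aᵀ * A + γ • (1 : Matrix (Fin d) (Fin d) ℝ))⁻¹ *ᵥ (Aᵀ *ᵥ y)) := by
  obtain ⟨hb0, hb1⟩ := hb
  set H := Aᵀ * A + γ • (1 : Matrix (Fin d) (Fin d) ℝ) with hH
  set K := Bᵀ * B + (δ + γ) • (1 : Matrix (Fin d) (Fin d) ℝ) with hK
  set s := H⁻¹ *ᵥ (Aᵀ *ᵥ y) with hs
  have hHdet : IsUnit H.det :=
    (isUnit_iff_isUnit_det H).mp (posDef_transpose_mul_self_add_smul_one A hγ).isUnit
  have hKdet : IsUnit K.det :=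
    (isUnit_iff_isUnit_det K).mp
      (posDef_transpose_mul_self_add_smul_one B (add_pos_of_nonneg_of_pos hδ hγ)).isUnit
  have hHs : H *ᵥ s = Aᵀ *ᵥ y := by
    rw [hs, mulVec_mulVec, mul_nonsing_inv _ hHdet, one_mulVec]
  have hKγ : (K - γ • (1 : Matrix (Fin d) (Fin d) ℝ)).PosSemidef := by
    have hB : (Bᵀ * B).PosSemidef := by simpa using posSemidef_conjTranspose_mul_self B
    have h := hB.add ((Matrix.PosSemidef.one (n := Fin d) (R := ℝ)).smul hδ)
    convert h using 1
    rw [hK]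
    module
  have hE : (H - K).PosSemidef := by
    convert hRFD₂ using 1
    rw [hH, hK]
    module
  have hcE : ((e / 2) • (1 : Matrix (Fin d) (Fin d) ℝ) - (H - K)).PosSemidef := by
    convert hRFD₁ using 1
    rw [hH, hK]
    module
  have he0 : 0 ≤ e / 2 := by
    rw [he]
    positivity
  have hrate : e / 2 / γ ≤ b / (2 - b) := by
    have : e / 2 / γ = b / 2 := by
      rw [he]
      field_simp
    rw [this]
    gcongr <;> linarith
  have hrate0 : 0 ≤ b / (2 - b) := div_nonneg hb0.le (by linarith)
  intro t
  induction t with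
  | zero => simp [hx0, eNorm_neg]
  | succ t ih =>
    have hstep : K *ᵥ (x (t + 1) - s) = (H - K) *ᵥ (-(x t - s)) := by
      rw [hxstep, ← hHs, mulVec_sub, mulVec_sub, mulVec_mulVec, mul_nonsing_inv _ hKdet,
        one_mulVec, mulVec_neg, sub_mulVec, mulVec_sub, mulVec_sub]
      abel
    calc eNorm (x (t + 1) - s) ≤ e / 2 / γ * eNorm (x t - s) := by
          simpa only [eNorm_neg] using eNorm_le_of_mulVec_eq hγ he0 hKγ hE hcE hstep
      _ ≤ b / (2 - b) * ((b / (2 - b)) ^ t * eNorm s) :=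
          mul_le_mul hrate ih (eNorm_nonneg _) hrate0
      _ = (b / (2 - b)) ^ (t + 1) * eNorm s := by ring
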